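/- Let b ∈ ℝ and suppose that max Σ_b(L) ≥ 0 for every lower set L of X (i.e., the empty set is a minimal lower set with respect to b). Then for every lower set L of X and all reals b₁, b₂ with b₂ ≤ b₁ ≤ b, one has Σ_{x∈L} ℓ(g(x), b₁) ≤ Σ_{x∈L} ℓ(g(x), b₂). -/

import Mathlib

open Pointwise Finset
open scoped Classical

variable {X : Type*}

/-- `f` is isotonic on the subset `S` of `X`. -/
def IsotonicOn [PartialOrder X] (f : X → ℝ) (S : Finset X) : Prop :=
  ∀ x ∈ S, ∀ y ∈ S, x ≤ y → f x ≤ f y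

/-- The separable loss `J_S(g, f) = Σ_{x∈S} ℓ(g(x), f(x))`. -/
noncomputable def lossJ (ℓ : ℝ → ℝ → ℝ) (g : X → ℝ) (S : Finset X) (f : X → ℝ) : ℝ :=
  ∑ x ∈ S, ℓ (g x) (f x)

/-- The subdifferential of the convex function `ℓ(a, ·)` at `b`. -/
def subdiff (ℓ : ℝ → ℝ → ℝ) (a b : ℝ) : Set ℝ :=
  {s : ℝ | ∀ y : ℝ, ℓ a b + s * (y - b) ≤ ℓ a y}

/-- `Σ_b(S) = −Σ_{x∈S} ∂ℓ(g(x), b)` (Minkowski sum; `Σ_b(∅) = {0}`). -/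
noncomputable def SigmaSet (ℓ : ℝ → ℝ → ℝ) (g : X → ℝ) (b : ℝ) (S : Finset X) : Set ℝ :=
  -∑ x ∈ S, subdiff ℓ (g x) b

/-- `U` is an upper set of `X`. -/
def IsUpperFinset [PartialOrder X] (U : Finset X) : Prop :=
  ∀ x ∈ U, ∀ y : X, x ≤ y → y ∈ U

/-- `L` is a lower set of `X`. -/
def IsLowerFinset [PartialOrder X] (L : Finset X) : Prop :=
  ∀ y ∈ L, ∀ x : X, x ≤ y → x ∈ L

/-- `U` is a maximal upper set with respect to `b`:
it maximizes `min Σ_b(U')` over all upper sets `U'`. -/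
def IsMaxUpper [PartialOrder X] (ℓ : ℝ → ℝ → ℝ) (g : X → ℝ) (b : ℝ) (U : Finset X) : Prop :=
  IsUpperFinset U ∧ ∀ U' : Finset X, IsUpperFinset U' →
    sInf (SigmaSet ℓ g b U') ≤ sInf (SigmaSet ℓ g b U)

/-- `L` is a minimal lower set with respect to `b`:
it minimizes `max Σ_b(L')` over all lower sets `L'`. -/
def IsMinLower [PartialOrder X] (ℓ : ℝ → ℝ → ℝ) (g : X → ℝ) (b : ℝ) (L : Finset X) : Prop :=
  IsLowerFinset L ∧ ∀ L' : Finset X, IsLowerFinset L' →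
    sSup (SigmaSet ℓ g b L) ≤ sSup (SigmaSet ℓ g b L')

/-- A finite convex function on `ℝ` has a subgradient at every point. -/
theorem subdiff_nonempty (ℓ : ℝ → ℝ → ℝ) (a b : ℝ)
    (hconv : ConvexOn ℝ (Set.univ : Set ℝ) (ℓ a)) : (subdiff ℓ a b).Nonempty := by
  have hb : b ∈ interior (Set.univ : Set ℝ) := by simp
  refine ⟨derivWithin (ℓ a) (Set.Ioi b) b, fun y => ?_⟩
  rcases lt_trichotomy y b with hy | rfl | hy
  · have h := (hconv.slope_le_leftDeriv_of_mem_interior (Set.mem_univ y) hb hy).trans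
      (hconv.leftDeriv_le_rightDeriv_of_mem_interior hb)
    rw [slope_def_field, div_le_iff₀ (sub_pos.2 hy)] at h
    linarith
  · simp
  · have h := hconv.rightDeriv_le_slope_of_mem_interior hb (Set.mem_univ y) hy
    rw [slope_def_field, le_div_iff₀ (sub_pos.2 hy)] at h
    linarith

theorem SigmaSet_nonempty (ℓ : ℝ → ℝ → ℝ)
    (hconv : ∀ a : ℝ, ConvexOn ℝ (Set.univ : Set ℝ) (ℓ a)) (g : X → ℝ) (b : ℝ) (S : Finset X) :
    (SigmaSet ℓ g b S).Nonempty := by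
  choose s hs using fun x => subdiff_nonempty ℓ (g x) b (hconv (g x))
  exact Set.Nonempty.neg ⟨_, Set.finsetSum_mem_finsetSum S _ s fun x _ => hs x⟩

/-- The negative of an element of `Σ_b(S)` is a subgradient at `b` of the total loss over `S`. -/
theorem sum_sub_mul_le_sum_of_mem_SigmaSet {ℓ : ℝ → ℝ → ℝ} {g : X → ℝ} {b t : ℝ} {S : Finset X}
    (ht : t ∈ SigmaSet ℓ g b S) (y : ℝ) :
    ∑ x ∈ S, ℓ (g x) b - t * (y - b) ≤ ∑ x ∈ S, ℓ (g x) y := by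
  obtain ⟨s, hs, hsum⟩ := (Set.mem_finsetSum _ _ _).1 (Set.mem_neg.1 ht)
  have h := Finset.sum_le_sum fun x (hx : x ∈ S) => hs hx y
  rw [Finset.sum_add_distrib, ← Finset.sum_mul, hsum] at h
  linarith

/-- If `max Σ_b(L) ≥ 0` for every lower set `L` of `X`, then for every
lower set `L` and all `b₂ ≤ b₁ ≤ b`, `Σ_{x∈L} ℓ(g(x), b₁) ≤ Σ_{x∈L} ℓ(g(x), b₂)`. -/
theorem lower_set_loss_monotone_below
    [Fintype X] [Nonempty X] [PartialOrder X]
    (ℓ : ℝ → ℝ → ℝ) (hconv : ∀ a : ℝ, ConvexOn ℝ (Set.univ : Set ℝ) (ℓ a))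
    (g : X → ℝ) (b : ℝ)
    (hmin : ∀ L : Finset X, IsLowerFinset L → 0 ≤ sSup (SigmaSet ℓ g b L)) :
    ∀ L : Finset X, IsLowerFinset L → ∀ b₁ b₂ : ℝ, b₂ ≤ b₁ → b₁ ≤ b →
      ∑ x ∈ L, ℓ (g x) b₁ ≤ ∑ x ∈ L, ℓ (g x) b₂ := by
  intro L hL b₁ b₂ h₂₁ h₁b
  by_contra! hlt
  have hF : ConvexOn ℝ Set.univ fun y => ∑ x ∈ L, ℓ (g x) y :=
    ⟨convex_univ, fun y _ z _ p q hp hq hpq => by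
      simpa [Finset.mul_sum, Finset.sum_add_distrib] using
        Finset.sum_le_sum fun x (_ : x ∈ L) =>
          (hconv (g x)).2 (Set.mem_univ y) (Set.mem_univ z) hp hq hpq⟩
  have hb₂₁ : b₂ < b₁ := h₂₁.lt_of_ne (by rintro rfl; exact hlt.false)
  have hb₂ : b₂ < b := hb₂₁.trans_le h₁b
  have hFb : ∑ x ∈ L, ℓ (g x) b₂ < ∑ x ∈ L, ℓ (g x) b :=
    hlt.trans_le <| (hF.strictMonoOn (Set.mem_univ b₂) hb₂₁ hlt).monotoneOn
      ⟨Set.mem_univ _, Set.self_mem_Ici⟩ ⟨Set.mem_univ _, h₁b⟩ h₁b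
  have hle : sSup (SigmaSet ℓ g b L) ≤
      -((∑ x ∈ L, ℓ (g x) b - ∑ x ∈ L, ℓ (g x) b₂) / (b - b₂)) := by
    refine csSup_le (SigmaSet_nonempty ℓ hconv g b L) fun t ht => ?_
    rw [le_neg, div_le_iff₀ (sub_pos.2 hb₂)]
    linarith [sum_sub_mul_le_sum_of_mem_SigmaSet ht b₂]
  linarith [hmin L hL, div_pos (sub_pos.2 hFb) (sub_pos.2 hb₂)]
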